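/- If a one-dimensional cellular automaton F on Q^ℤ with neighborhood [-l,r] is k-expansive for every k ≥ 1, then F is pre-expansive, with constant 2^{-max(l,r)}. -/

import Mathlib

/-- `k`-expansivity: some finite window `[-m, m]` eventually witnesses any pair of
configurations differing in exactly `k` positions. -/
def KExpansive {Q : Type*} (k : ℕ) (F : (ℤ → Q) → ℤ → Q) : Prop :=
  ∃ m : ℕ, ∀ c d : ℤ → Q, {z | c z ≠ d z}.ncard = k →
    ∃ t : ℕ, ∃ x : ℤ, |x| ≤ (m : ℤ) ∧ F^[t] c x ≠ F^[t] d x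

/-- Iterates of a cellular automaton commute with translations. -/
theorem iterate_shift_of_local_rule {Q : Type*} (l r : ℕ)
    (f : (Fin (l + r + 1) → Q) → Q) (F : (ℤ → Q) → ℤ → Q)
    (hF : ∀ c z, F c z = f fun i => c (z - (l : ℤ) + (i.val : ℤ)))
    (c : ℤ → Q) (s : ℤ) (t : ℕ) :
    F^[t] (fun x => c (x + s)) = fun x => F^[t] c (x + s) := by
  induction t with
  | zero => rfl
  | succ t ih =>
    funext x
    rw [Function.iterate_succ_apply', Function.iterate_succ_apply', ih, hF, hF]
    refine congrArg f (funext fun i => congrArg (F^[t] c) ?_)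
    ring

/-- If the orbits of `c` and `d` agree on the window `[-max l r, max l r]`, then the orbit of the
configuration glued from `c` on the left and `d` on the right is glued in the same way. -/
theorem iterate_glue_of_local_rule {Q : Type*} (l r : ℕ)
    (f : (Fin (l + r + 1) → Q) → Q) (F : (ℤ → Q) → ℤ → Q)
    (hF : ∀ c z, F c z = f fun i => c (z - (l : ℤ) + (i.val : ℤ)))
    (c d : ℤ → Q)
    (h : ∀ t : ℕ, ∀ x : ℤ, |x| ≤ ((max l r : ℕ) : ℤ) → F^[t] c x = F^[t] d x) (t : ℕ) :
    F^[t] (fun x => if x ≤ 0 then c x else d x) =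
      fun x => if x ≤ 0 then F^[t] c x else F^[t] d x := by
  induction t with
  | zero => rfl
  | succ t ih =>
    funext x
    rw [Function.iterate_succ_apply', Function.iterate_succ_apply',
      Function.iterate_succ_apply', ih, hF, hF, hF]
    split_ifs with hx
    · congr 1
      funext i
      have hi := i.isLt
      split_ifs with hy
      · rfl
      · exact (h t _ (abs_le.2 (by omega))).symm
    · congr 1
      funext i
      split_ifs with hy
      · exact h t _ (abs_le.2 (by omega))
      · rfl

/-- Under `k`-expansivity for every `k ≥ 1`, an asymptotic pair whose orbits agree on translates
of arbitrarily large windows is trivial. -/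
theorem eq_of_forall_window_agree {Q : Type*} (l r : ℕ)
    (f : (Fin (l + r + 1) → Q) → Q) (F : (ℤ → Q) → ℤ → Q)
    (hF : ∀ c z, F c z = f fun i => c (z - (l : ℤ) + (i.val : ℤ)))
    (hexp : ∀ k : ℕ, 1 ≤ k → KExpansive k F) (c d : ℤ → Q) (hfin : {z | c z ≠ d z}.Finite)
    (h : ∀ m : ℕ, ∃ s : ℤ, ∀ t : ℕ, ∀ x : ℤ, |x| ≤ (m : ℤ) →
      F^[t] c (x + s) = F^[t] d (x + s)) : c = d := by
  by_contra hne
  have hpos : 1 ≤ {z | c z ≠ d z}.ncard :=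
    (Set.ncard_pos hfin).2 (Function.ne_iff.1 hne)
  obtain ⟨m, hm⟩ := hexp _ hpos
  obtain ⟨s, hs⟩ := h m
  obtain ⟨t, x, hx, hdiff⟩ := hm (fun x => c (x + s)) (fun x => d (x + s))
    (Set.ncard_preimage_of_injective_subset_range (s := {z | c z ≠ d z})
      (add_left_injective s) fun z _ => ⟨z - s, sub_add_cancel z s⟩)
  rw [iterate_shift_of_local_rule l r f F hF, iterate_shift_of_local_rule l r f F hF] at hdiff
  exact hdiff (hs t x hx)

/-- if a 1D CA with neighborhood `[-l, r]` is `k`-expansive for every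
`k ≥ 1`, then it is pre-expansive with constant `2^{-max(l,r)}`. -/
theorem preexpansive_of_all_k_expansive {Q : Type*} [Fintype Q] (l r : ℕ)
    (f : (Fin (l + r + 1) → Q) → Q) (F : (ℤ → Q) → ℤ → Q)
    (hF : ∀ c z, F c z = f fun i => c (z - (l : ℤ) + (i.val : ℤ)))
    (hexp : ∀ k : ℕ, 1 ≤ k → KExpansive k F) :
    ∀ c d : ℤ → Q, {z | c z ≠ d z}.Finite → c ≠ d →
      ∃ t : ℕ, ∃ x : ℤ, |x| ≤ ((max l r : ℕ) : ℤ) ∧ F^[t] c x ≠ F^[t] d x := by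
  intro c d hfin hne
  by_contra! h
  have hglue := iterate_glue_of_local_rule l r f F hF c d h
  have hce : c = fun x => if x ≤ 0 then c x else d x := by
    refine eq_of_forall_window_agree l r f F hF hexp _ _ (hfin.subset fun z hz => ?_)
      fun m => ⟨-m, fun t x hx => ?_⟩
    · by_cases hz0 : z ≤ 0 <;> simp_all
    · rw [congrFun (hglue t) (x + -m), if_pos (by have := abs_le.1 hx; omega)]
  refine hne (eq_of_forall_window_agree l r f F hF hexp c d hfin
    fun m => ⟨m + 1, fun t x hx => ?_⟩)
  rw [← hce] at hglue
  rw [congrFun (hglue t) (x + (m + 1)), if_neg (by have := abs_le.1 hx; omega)]
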